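/- Let M : [t₀−η, t₀+η] → Sym(k,ℝ) be a smooth path of symmetric matrices with M_{t₀±η} invertible, all of whose eigenvalue crossings through 0 are counted via continuous eigenvalue branches λ₁(t),…,λ_k(t). Setting M_z = M_t + is·Id for z = t+is in the rectangle D = [t₀−η,t₀+η]×[−1,1], one has (1/2πi)∮_{∂D} Tr(dM_z · M_z⁻¹) = μ(M_{t₀−η}) − μ(M_{t₀+η}), where μ denotes the number of negative eigenvalues (Morse index). -/

import Mathlib

lemma aux_inv {R : Type*} [NormedRing R] [NormedAlgebra ℝ R] [CompleteSpace R]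
    {f : ℝ → R} {f' : R} {x : ℝ} (hf : HasDerivAt f f' x) (hu : IsUnit (f x)) :
    HasDerivAt (fun y => Ring.inverse (f y))
      (-(Ring.inverse (f x) * f' * Ring.inverse (f x))) x := by
  obtain ⟨u, hu⟩ := hu
  have h := hasFDerivAt_ringInverse (𝕜 := ℝ) u
  rw [hu] at h
  have h2 := h.comp_hasDerivAt x hf
  rw [← hu, Ring.inverse_unit]
  refine HasDerivAt.congr_deriv h2 ?_
  simp

lemma aux_swap {R : Type*} [NormedRing R] [NormedAlgebra ℝ R] [CompleteSpace R]
    (T : R →L[ℝ] ℂ) (hT : ∀ x y, T (x * y) = T (y * x))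
    (M M' : ℝ → R) (hM : ∀ t, HasDerivAt M (M' t) t) (hM' : Continuous M') (c : R)
    (hu : ∀ t r : ℝ, IsUnit (r • M t + c)) (a b : ℝ) :
    ∫ t in a..b, T (M' t * Ring.inverse (M t + c)) =
      (∫ r in (0:ℝ)..1, T (M b * Ring.inverse (r • M b + c))) -
      ∫ r in (0:ℝ)..1, T (M a * Ring.inverse (r • M a + c)) := by
  have hMc : Continuous M := continuous_iff_continuousAt.2 fun t => (hM t).continuousAt
  have hA : Continuous fun p : ℝ × ℝ => Ring.inverse (p.2 • M p.1 + c) := by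
    rw [continuous_iff_continuousAt]
    intro p
    obtain ⟨u, hu'⟩ := hu p.1 p.2
    have h := NormedRing.inverse_continuousAt u
    rw [hu'] at h
    have h2 : ContinuousAt (fun p : ℝ × ℝ => p.2 • M p.1 + c) p := by fun_prop
    exact ContinuousAt.comp (f := fun p : ℝ × ℝ => p.2 • M p.1 + c) h h2
  set A : ℝ → ℝ → R := fun t r => Ring.inverse (r • M t + c) with hAdef
  have hA' : Continuous fun p : ℝ × ℝ => A p.1 p.2 := hA
  set D : ℝ → ℝ → ℂ := fun t r => T (M' t * A t r - r • (M' t * A t r * (M t * A t r))) with hD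
  have hDc : Continuous (Function.uncurry D) := by
    have : Continuous fun p : ℝ × ℝ =>
      T (M' p.1 * A p.1 p.2 - p.2 • (M' p.1 * A p.1 p.2 * (M p.1 * A p.1 p.2))) := by fun_prop
    exact this
  have h1 : ∀ t r, HasDerivAt (fun r => T (r • (M' t * A t r))) (D t r) r := by
    intro t r
    have e : HasDerivAt (fun r : ℝ => r • M t + c) (M t) r := by
      simpa using ((hasDerivAt_id r).smul_const (M t)).add_const c
    have e2 := aux_inv e (hu t r)
    have e3 := (hasDerivAt_id r).smul (e2.const_mul (M' t))
    have e4 := T.hasFDerivAt.comp_hasDerivAt r e3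
    refine HasDerivAt.congr_deriv e4 ?_
    symm
    simp only [hD, hAdef, id]
    congr 1
    simp [mul_assoc]
    abel
  have h2 : ∀ t r, HasDerivAt (fun t => T (M t * A t r)) (D t r) t := by
    intro t r
    have e : HasDerivAt (fun t : ℝ => r • M t + c) (r • M' t) t := by
      simpa using ((hM t).const_smul r).add_const c
    have e2 := aux_inv e (hu t r)
    have e3 := (hM t).mul e2
    have e4 := T.hasFDerivAt.comp_hasDerivAt t e3
    refine HasDerivAt.congr_deriv e4 ?_
    symm
    simp only [hD, hAdef]
    rw [map_sub, map_smul, hT (M' t * Ring.inverse (r • M t + c)) (M t * _)]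
    simp [mul_assoc, sub_eq_add_neg]
  have hDt : ∀ t, Continuous (D t) := fun t => hDc.comp (by fun_prop : Continuous fun r => (t, r))
  have hDr : ∀ r, Continuous (fun t => D t r) :=
    fun r => hDc.comp (by fun_prop : Continuous fun t => (t, r))
  have i1 : ∀ t, ∫ r in (0:ℝ)..1, D t r = T (M' t * Ring.inverse (M t + c)) := by
    intro t
    rw [intervalIntegral.integral_eq_sub_of_hasDerivAt (fun r _ => h1 t r)
      ((hDt t).intervalIntegrable _ _)]
    simp [hAdef]
  have i2 : ∀ r, ∫ t in a..b, D t r = T (M b * A b r) - T (M a * A a r) := by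
    intro r
    rw [intervalIntegral.integral_eq_sub_of_hasDerivAt (fun t _ => h2 t r)
      ((hDr r).intervalIntegrable _ _)]
  have hAr : ∀ t, Continuous (A t) := fun t => hA.comp (by fun_prop : Continuous fun r => (t, r))
  rw [← intervalIntegral.integral_sub, ← funext i2, ← funext i1]
  · apply MeasureTheory.intervalIntegral_intervalIntegral_swap
    exact (hDc.continuousOn.integrableOn_compact
      (isCompact_uIcc.prod isCompact_uIcc)).mono_set
      (Set.prod_mono Set.uIoc_subset_uIcc Set.uIoc_subset_uIcc)
  · exact (T.continuous.comp (continuous_const.mul (hAr b))).intervalIntegrable _ _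
  · exact (T.continuous.comp (continuous_const.mul (hAr a))).intervalIntegrable _ _

lemma aux_r (l σ : ℝ) (hσ : σ = 1 ∨ σ = -1) :
    ∫ r in (0:ℝ)..1, (l:ℂ) * ((r:ℂ) * l + Complex.I * σ)⁻¹ =
      ((1/2 * Real.log (l^2+1) : ℝ) : ℂ) - Complex.I * σ * (Real.arctan l : ℝ) := by
  have hs : σ^2 = 1 := by rcases hσ with h | h <;> simp [h]
  have hsC : (σ:ℂ)^2 = 1 := by exact_mod_cast hs
  have hne : ∀ r : ℝ, (r:ℂ) * l + Complex.I * σ ≠ 0 := by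
    intro r h
    have := congrArg Complex.im h
    simp at this
    simp [this] at hs
  have hd : ∀ r : ℝ, HasDerivAt (fun r : ℝ => ((1/2 * Real.log ((r*l)^2+1) : ℝ) : ℂ)
      - Complex.I * σ * (Real.arctan (r*l) : ℝ))
      ((l:ℂ) * ((r:ℂ) * l + Complex.I * σ)⁻¹) r := by
    intro r
    have hp : (r*l)^2+1 ≠ 0 := by positivity
    have e0 : HasDerivAt (fun r : ℝ => r * l) l r := by simpa using (hasDerivAt_id r).mul_const l
    have e1 := ((((e0.pow 2).add_const 1).log hp).const_mul (1/2)).ofReal_comp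
    have e2 := (e0.arctan.ofReal_comp).const_mul (Complex.I * σ)
    have e3 := e1.sub e2
    refine HasDerivAt.congr_deriv e3 ?_
    symm
    have hpC : (1:ℂ) + ((r:ℂ)*l)^2 ≠ 0 := by
      have : (1:ℝ) + (r*l)^2 ≠ 0 := by positivity
      exact_mod_cast this
    have hpC' : ((r:ℂ)*l)^2 + 1 ≠ 0 := by rwa [add_comm] at hpC
    have key : ((r:ℂ) * l + Complex.I * σ)⁻¹ = (r * l - Complex.I * σ) / (1 + (r*l)^2) := by
      rw [inv_eq_iff_eq_inv, inv_div, eq_div_iff]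
      · linear_combination -Complex.I^2 * hsC - Complex.I_sq
      · intro h
        have := congrArg Complex.im h
        simp at this
        simp [this] at hs
    rw [key]
    simp only [Pi.pow_apply]
    push_cast
    rw [add_comm (((r:ℂ)*l)^2)]
    field_simp
  rw [intervalIntegral.integral_eq_sub_of_hasDerivAt (fun r _ => hd r)]
  · simp
  · apply Continuous.intervalIntegrable
    exact continuous_const.mul (Continuous.inv₀ (by fun_prop) hne)

lemma aux_s (l : ℝ) (hl : l ≠ 0) :
    ∫ s in (-1:ℝ)..1, Complex.I * ((l:ℂ) + Complex.I * s)⁻¹ =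
      2 * Complex.I * (Real.arctan l⁻¹ : ℝ) := by
  have hne : ∀ s : ℝ, (l:ℂ) + Complex.I * s ≠ 0 := by
    intro r h
    have := congrArg Complex.re h
    simp at this
    exact hl this
  have hd : ∀ s : ℝ, HasDerivAt (fun s : ℝ => ((1/2 * Real.log (l^2+s^2) : ℝ) : ℂ)
      + Complex.I * (Real.arctan (s*l⁻¹) : ℝ))
      (Complex.I * ((l:ℂ) + Complex.I * s)⁻¹) s := by
    intro s
    have hp : l^2+s^2 ≠ 0 := by positivity
    have e0 : HasDerivAt (fun r : ℝ => r * l⁻¹) l⁻¹ s := by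
      simpa using (hasDerivAt_id s).mul_const l⁻¹
    have e1 := (((((hasDerivAt_id s).pow 2).const_add (l^2)).log hp).const_mul (1/2)).ofReal_comp
    have e2 := (e0.arctan.ofReal_comp).const_mul (Complex.I)
    have e3 := e1.add e2
    refine HasDerivAt.congr_deriv e3 ?_
    symm
    have hlC : (l:ℂ) ≠ 0 := by exact_mod_cast hl
    have hpC : (l:ℂ)^2+s^2 ≠ 0 := by exact_mod_cast hp
    have key : ((l:ℂ) + Complex.I * s)⁻¹ = (l - Complex.I * s) / (l^2 + s^2) := by
      rw [inv_eq_iff_eq_inv, inv_div, eq_div_iff]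
      · linear_combination -(s:ℂ)^2 * Complex.I_sq
      · intro h
        have := congrArg Complex.re h
        simp at this
        exact hl this
    have k2 : 1 / (1 + (s * l⁻¹)^2) * l⁻¹ = l / (l^2+s^2) := by
      field_simp
    rw [key, k2]
    simp only [Pi.pow_apply, id]
    push_cast
    field_simp
    linear_combination -(s:ℂ) * Complex.I_sq
  rw [intervalIntegral.integral_eq_sub_of_hasDerivAt (fun r _ => hd r)]
  · simp
    ring
  · apply Continuous.intervalIntegrable
    exact continuous_const.mul (Continuous.inv₀ (by fun_prop) hne)

lemma aux_scalar (l : ℝ) (hl : l ≠ 0) :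
    (∫ r in (0:ℝ)..1, (l:ℂ) * ((r:ℂ) * l + Complex.I * (-1 : ℝ))⁻¹) +
    (∫ s in (-1:ℝ)..1, Complex.I * ((l:ℂ) + Complex.I * s)⁻¹) -
    (∫ r in (0:ℝ)..1, (l:ℂ) * ((r:ℂ) * l + Complex.I * (1 : ℝ))⁻¹) =
      Real.pi * Complex.I * (1 - 2 * if l < 0 then 1 else 0) := by
  rw [aux_r l 1 (by simp), aux_r l (-1) (by simp), aux_s l hl]
  rcases lt_or_gt_of_ne hl with h | h
  · rw [Real.arctan_inv_of_neg h, if_pos h]; push_cast; ring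
  · rw [Real.arctan_inv_of_pos h, if_neg (not_lt.2 h.le)]; push_cast; ring

lemma aux_diag {k : ℕ} (M : Matrix (Fin k) (Fin k) ℝ) (hM : M.IsHermitian) :
    ∃ U V : Matrix (Fin k) (Fin k) ℂ, U * V = 1 ∧ V * U = 1 ∧
      M.map Complex.ofReal = U * Matrix.diagonal (fun i => (hM.eigenvalues i : ℂ)) * V := by
  refine ⟨(hM.eigenvectorUnitary : Matrix (Fin k) (Fin k) ℝ).map Complex.ofRealHom,
    (star hM.eigenvectorUnitary : Matrix (Fin k) (Fin k) ℝ).map Complex.ofRealHom, ?_, ?_, ?_⟩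
  · rw [← Matrix.map_mul]; simp
  · rw [← Matrix.map_mul]; simp
  · conv_lhs => rw [hM.spectral_theorem]
    rw [Unitary.conjStarAlgAut_apply]
    change (Matrix.map _ Complex.ofRealHom) = _
    rw [Matrix.map_mul, Matrix.map_mul, Matrix.diagonal_map (by simp)]
    rfl

lemma aux_mulinv {k : ℕ} (M : Matrix (Fin k) (Fin k) ℝ) (hM : M.IsHermitian) (r : ℝ) (c : ℂ)
    (h : ∀ i, (r:ℂ) * hM.eigenvalues i + c ≠ 0) :
    IsUnit (r • M.map Complex.ofReal + c • (1 : Matrix (Fin k) (Fin k) ℂ)) ∧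
    ((r • M.map Complex.ofReal + c • (1 : Matrix (Fin k) (Fin k) ℂ))⁻¹).trace =
      ∑ i, ((r:ℂ) * hM.eigenvalues i + c)⁻¹ ∧
    (M.map Complex.ofReal *
      (r • M.map Complex.ofReal + c • (1 : Matrix (Fin k) (Fin k) ℂ))⁻¹).trace =
      ∑ i, hM.eigenvalues i * ((r:ℂ) * hM.eigenvalues i + c)⁻¹ := by
  obtain ⟨U, V, hUV, hVU, hD⟩ := aux_diag M hM
  set l := hM.eigenvalues
  have e1 : r • M.map Complex.ofReal + c • (1 : Matrix (Fin k) (Fin k) ℂ) =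
      U * Matrix.diagonal (fun i => (r:ℂ) * l i + c) * V := by
    have : Matrix.diagonal (fun i => (r:ℂ) * l i + c) =
        r • Matrix.diagonal (fun i => (l i : ℂ)) + c • (1 : Matrix (Fin k) (Fin k) ℂ) := by
      ext i j
      by_cases hij : i = j <;> simp [hij, Matrix.diagonal]
    rw [this, hD]
    simp [mul_add, add_mul, hUV]
  have e2 : (r • M.map Complex.ofReal + c • (1 : Matrix (Fin k) (Fin k) ℂ)) *
      (U * Matrix.diagonal (fun i => ((r:ℂ) * l i + c)⁻¹) * V) = 1 := by
    rw [e1]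
    calc _ = U * (Matrix.diagonal (fun i => (r:ℂ) * l i + c) * (V * U) *
          Matrix.diagonal (fun i => ((r:ℂ) * l i + c)⁻¹)) * V := by simp only [mul_assoc]
      _ = 1 := by
        rw [hVU, mul_one, Matrix.diagonal_mul_diagonal]
        simp [h, hUV]
  refine ⟨IsUnit.of_mul_eq_one _ e2, ?_, ?_⟩
  · rw [Matrix.inv_eq_right_inv e2, Matrix.trace_mul_comm, ← mul_assoc, hVU, one_mul,
      Matrix.trace_diagonal]
  · rw [Matrix.inv_eq_right_inv e2, hD]
    calc _ = (U * (Matrix.diagonal (fun i => (l i : ℂ)) * (V * U) *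
          Matrix.diagonal (fun i => ((r:ℂ) * l i + c)⁻¹) * V)).trace := by simp only [mul_assoc]
      _ = _ := by
        rw [Matrix.trace_mul_comm, hVU, mul_one, mul_assoc, hVU, mul_one,
          Matrix.diagonal_mul_diagonal, Matrix.trace_diagonal]

section
attribute [local instance] Matrix.linftyOpNormedRing Matrix.linftyOpNormedAlgebra

lemma aux_path {k : ℕ} (M : ℝ → Matrix (Fin k) (Fin k) ℝ)
    (hM : ∀ t, (M t).IsHermitian)
    (hsm : ∀ i j, ContDiff ℝ 1 fun t => M t i j) (a b σ : ℝ) (hσ : σ ≠ 0) :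
    (∫ t in a..b,
          ((Matrix.of fun i j => Complex.ofReal (deriv (fun τ => M τ i j) t)) *
            ((M t).map Complex.ofReal + (Complex.I * (σ : ℂ)) •
              (1 : Matrix (Fin k) (Fin k) ℂ))⁻¹).trace) =
    (∑ i, ∫ r in (0:ℝ)..1, ((hM b).eigenvalues i : ℂ) *
        ((r:ℂ) * (hM b).eigenvalues i + Complex.I * σ)⁻¹) -
    ∑ i, ∫ r in (0:ℝ)..1, ((hM a).eigenvalues i : ℂ) *
        ((r:ℂ) * (hM a).eigenvalues i + Complex.I * σ)⁻¹ := by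
  have hne : ∀ r l : ℝ, (r:ℂ) * l + Complex.I * σ ≠ 0 := by
    intro r l h
    have := congrArg Complex.im h
    simp at this
    exact hσ this
  let T : Matrix (Fin k) (Fin k) ℂ →L[ℝ] ℂ :=
    ⟨Matrix.traceLinearMap (Fin k) ℝ ℂ, continuous_id.matrix_trace⟩
  have key := aux_swap T (fun x y => Matrix.trace_mul_comm x y)
    (fun t => (M t).map Complex.ofReal)
    (fun t => Matrix.of fun i j => Complex.ofReal (deriv (fun τ => M τ i j) t))
    (by
      intro t
      refine hasDerivAt_pi.2 fun i => hasDerivAt_pi.2 fun j => ?_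
      exact (((hsm i j).differentiable (by norm_num)) t).hasDerivAt.ofReal_comp)
    (by
      refine continuous_matrix fun i j => ?_
      exact Complex.continuous_ofReal.comp ((hsm i j).continuous_deriv (by norm_num)))
    ((Complex.I * (σ : ℂ)) • 1)
    (fun t r => (aux_mulinv (M t) (hM t) r _ fun i => hne _ _).1) a b
  simp only [← Matrix.nonsing_inv_eq_ringInverse] at key
  refine Eq.trans key ?_
  have hs : ∀ t, ∫ r in (0:ℝ)..1, ((M t).map Complex.ofReal *
      (r • (M t).map Complex.ofReal + (Complex.I * (σ : ℂ)) •
        (1 : Matrix (Fin k) (Fin k) ℂ))⁻¹).trace =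
      ∑ i, ∫ r in (0:ℝ)..1, ((hM t).eigenvalues i : ℂ) *
        ((r:ℂ) * (hM t).eigenvalues i + Complex.I * σ)⁻¹ := by
    intro t
    rw [← intervalIntegral.integral_finsetSum]
    · congr 1
      ext r
      exact (aux_mulinv (M t) (hM t) r _ fun i => hne _ _).2.2
    · intro i _
      apply Continuous.intervalIntegrable
      exact continuous_const.mul (Continuous.inv₀ (by fun_prop) fun r => hne _ _)
  exact congrArg₂ (fun x y : ℂ => x - y) (hs b) (hs a)

end

lemma aux_ev {k : ℕ} (M : Matrix (Fin k) (Fin k) ℝ) (hM : M.IsHermitian) (hd : M.det ≠ 0) (i) :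
    hM.eigenvalues i ≠ 0 := by
  intro h
  apply hd
  rw [hM.det_eq_prod_eigenvalues]
  exact Finset.prod_eq_zero (Finset.mem_univ i) (by simp [h])

lemma aux_side {k : ℕ} (M : Matrix (Fin k) (Fin k) ℝ) (hM : M.IsHermitian) (hd : M.det ≠ 0) :
    (∫ s in (-1:ℝ)..1, Complex.I *
            ((M.map Complex.ofReal + (Complex.I * (s : ℂ)) •
              (1 : Matrix (Fin k) (Fin k) ℂ))⁻¹).trace) =
    ∑ i, ∫ s in (-1:ℝ)..1, Complex.I * ((hM.eigenvalues i:ℂ) + Complex.I * s)⁻¹ := by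
  have hne : ∀ (s : ℝ) i, (hM.eigenvalues i : ℂ) + Complex.I * s ≠ 0 := by
    intro r i h
    have := congrArg Complex.re h
    simp at this
    exact aux_ev M hM hd i this
  rw [← intervalIntegral.integral_finsetSum]
  · congr 1
    ext s
    have := (aux_mulinv M hM 1 (Complex.I * s) (by simpa using hne s)).2.1
    simp only [one_smul, Complex.ofReal_one, one_mul] at this
    rw [this, Finset.mul_sum]
  · intro i _
    apply Continuous.intervalIntegrable
    exact continuous_const.mul (Continuous.inv₀ (by fun_prop) fun r => hne _ _)

lemma aux_total {k : ℕ} (M : Matrix (Fin k) (Fin k) ℝ) (hM : M.IsHermitian) (hd : M.det ≠ 0) :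
    (∑ i, ∫ r in (0:ℝ)..1, (hM.eigenvalues i:ℂ) *
        ((r:ℂ) * hM.eigenvalues i + Complex.I * (-1 : ℝ))⁻¹) +
    (∑ i, ∫ s in (-1:ℝ)..1, Complex.I * ((hM.eigenvalues i:ℂ) + Complex.I * s)⁻¹) -
    (∑ i, ∫ r in (0:ℝ)..1, (hM.eigenvalues i:ℂ) *
        ((r:ℂ) * hM.eigenvalues i + Complex.I * (1 : ℝ))⁻¹) =
      Real.pi * Complex.I *
        (k - 2 * ((Finset.univ.filter fun i => hM.eigenvalues i < 0).card : ℂ)) := by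
  rw [← Finset.sum_add_distrib, ← Finset.sum_sub_distrib,
    Finset.sum_congr rfl fun i _ => aux_scalar _ (aux_ev M hM hd i), ← Finset.mul_sum,
    Finset.sum_sub_distrib, ← Finset.mul_sum]
  simp

/-- For a smooth path `M_t` of real symmetric `k×k` matrices with
`M_{t₀±η}` invertible, setting `M_z = M_t + is·Id` for `z = t + is` in the rectangle
`D = [t₀−η,t₀+η] × [−1,1]`, the contour integral `(1/2πi)∮_{∂D} Tr(dM_z M_z⁻¹)`
(bottom side left to right, right side, top side right to left, left side) equals
`μ(M_{t₀−η}) − μ(M_{t₀+η})`, the difference of the numbers of negative eigenvalues. -/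
theorem stmt_13
    (k : ℕ) (t₀ η : ℝ) (hη : 0 < η)
    (M : ℝ → Matrix (Fin k) (Fin k) ℝ)
    (hM : ∀ t, (M t).IsHermitian)
    (hsm : ∀ i j, ContDiff ℝ 1 fun t => M t i j)
    (hm : (M (t₀ - η)).det ≠ 0) (hp : (M (t₀ + η)).det ≠ 0) :
    (1 / (2 * (Real.pi : ℂ) * Complex.I)) *
      ((∫ t in (t₀ - η)..(t₀ + η),
          ((Matrix.of fun i j => Complex.ofReal (deriv (fun τ => M τ i j) t)) *
            ((M t).map Complex.ofReal + (Complex.I * ((-1 : ℝ) : ℂ)) •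
              (1 : Matrix (Fin k) (Fin k) ℂ))⁻¹).trace)
        + (∫ s in (-1:ℝ)..1, Complex.I *
            (((M (t₀ + η)).map Complex.ofReal + (Complex.I * (s : ℂ)) •
              (1 : Matrix (Fin k) (Fin k) ℂ))⁻¹).trace)
        - (∫ t in (t₀ - η)..(t₀ + η),
          ((Matrix.of fun i j => Complex.ofReal (deriv (fun τ => M τ i j) t)) *
            ((M t).map Complex.ofReal + (Complex.I * ((1 : ℝ) : ℂ)) •
              (1 : Matrix (Fin k) (Fin k) ℂ))⁻¹).trace)
        - (∫ s in (-1:ℝ)..1, Complex.I *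
            (((M (t₀ - η)).map Complex.ofReal + (Complex.I * (s : ℂ)) •
              (1 : Matrix (Fin k) (Fin k) ℂ))⁻¹).trace)) =
    ((Finset.univ.filter fun i => (hM (t₀ - η)).eigenvalues i < 0).card : ℂ) -
      ((Finset.univ.filter fun i => (hM (t₀ + η)).eigenvalues i < 0).card : ℂ) := by
  rw [aux_path M hM hsm _ _ (-1) (by norm_num), aux_path M hM hsm _ _ 1 (by norm_num),
    aux_side _ (hM (t₀ + η)) hp, aux_side _ (hM (t₀ - η)) hm]
  have h1 := aux_total _ (hM (t₀ + η)) hp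
  have h2 := aux_total _ (hM (t₀ - η)) hm
  have hpi : (Real.pi : ℂ) ≠ 0 := by exact_mod_cast Real.pi_ne_zero
  have hI := Complex.I_ne_zero
  rw [div_mul_eq_mul_div, one_mul, div_eq_iff (by simp [hpi])]
  linear_combination h1 - h2
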